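/- There exists a perfect trace of the 2-player Hanabi bookkeeping model of length exactly 71. -/

import Mathlib

/-- A state of the Hanabi bookkeeping model:
`m` hint tokens, `d` cards left in the deck, `q` remaining turns once the
deck is empty, `f` completed fireworks, `s` score. -/
structure HState where
  m : ℕ
  d : ℕ
  q : ℕ
  f : ℕ
  s : ℕ

/-- The invariants a state must satisfy. -/
def HState.valid (st : HState) : Prop :=
  st.m ≤ 8 ∧ st.f ≤ 5 ∧ 5 * st.f ≤ st.s ∧ st.s ≤ 20 + st.f

/-- The possible kinds of turns. -/
inductive HAction where
  | hint | discard | playFail | playSucc | playComplete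
deriving DecidableEq

/-- Is the action a play (successful or not, possibly firework-completing)? -/
def HAction.isPlay : HAction → Prop
  | .hint => False
  | .discard => False
  | _ => True

instance : DecidablePred HAction.isPlay := by
  intro a; cases a <;> simp [HAction.isPlay] <;> infer_instance

/-- A turn of kind `a` from state `st` to state `st'`. -/
def Step (a : HAction) (st st' : HState) : Prop :=
  st.valid ∧ st'.valid ∧
  -- a turn is allowed only if the score is below 25 and the game is not over
  st.s < 25 ∧ (1 ≤ st.d ∨ 1 ≤ st.q) ∧
  -- update of the deck size and of the remaining-turns counter
  st'.d = (if 1 ≤ st.d ∧ a ≠ .hint then st.d - 1 else st.d) ∧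
  st'.q = (if st.d = 0 then st.q - 1 else st.q) ∧
  -- effect of the individual actions
  (match a with
  | .hint => 1 ≤ st.m ∧ st'.m = st.m - 1 ∧ st'.f = st.f ∧ st'.s = st.s
  | .discard => st.m ≤ 7 ∧ st'.m = st.m + 1 ∧ st'.f = st.f ∧ st'.s = st.s
  | .playFail => st'.m = st.m ∧ st'.f = st.f ∧ st'.s = st.s
  | .playSucc => st'.m = st.m ∧ st'.f = st.f ∧ st'.s = st.s + 1
  | .playComplete =>
      st.f ≤ 4 ∧ st'.m = min (st.m + 1) 8 ∧ st'.f = st.f + 1 ∧ st'.s = st.s + 1)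

/-- Hand size for `p` players. -/
def handSize (p : ℕ) : ℕ := if p ≤ 3 then 5 else 4

/-- Initial deck size for `p` players. -/
def initialDeck (p : ℕ) : ℕ := 50 - p * handSize p

/-- The initial state for `p` players. -/
def initState (p : ℕ) : HState := ⟨8, initialDeck p, p, 0, 0⟩

/-- A trace of length `n` (i.e. with `n` turns) of the `p`-player Hanabi
bookkeeping model: `n + 1` states starting at the initial state, with
consecutive states related by turns. -/
structure Trace (p n : ℕ) where
  state : Fin (n + 1) → HState
  action : Fin n → HAction
  init : state 0 = initState p
  step : ∀ t : Fin n, Step (action t) (state t.castSucc) (state t.succ)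

instance (st : HState) : Decidable st.valid := by
  unfold HState.valid; infer_instance

instance (a : HAction) (st st' : HState) : Decidable (Step a st st') := by
  unfold Step; cases a <;> infer_instance

/-- The action taken at time `t` in a perfect game of length 71: 8 hints, 22 successful plays
completing four fireworks, 4 hints, 17 alternations of discard and hint, 3 successful plays. -/
def longGameAction (t : ℕ) : HAction :=
  if t < 8 then .hint
  else if t < 30 then (if t % 5 = 2 then .playComplete else .playSucc)
  else if t < 34 then .hint
  else if t < 68 then (if t % 2 = 0 then .discard else .hint)
  else if t < 70 then .playSucc
  else .playComplete

/-- The state reached after `t` turns of `longGameAction`, for `t ≤ 71`. -/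
def longGameState (t : ℕ) : HState where
  m := if t ≤ 8 then 8 - t
    else if t ≤ 30 then (t - 8) / 5
    else if t ≤ 34 then 34 - t
    else if t ≤ 68 then t % 2
    else t - 70
  d := if t ≤ 30 then 40 - (t - 8)
    else if t ≤ 68 then 18 - (t - 33) / 2
    else 0
  q := min 2 (71 - t)
  f := (min t 30 - 8) / 5 + (t - 70)
  s := (min t 30 - 8) + (t - 68)

theorem longGame_step : ∀ t : Fin 71,
    Step (longGameAction t) (longGameState t) (longGameState (t + 1)) := by
  decide

/-- There exists a perfect trace of the 2-player Hanabi bookkeeping model of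
length exactly 71. -/
theorem hanabi_two_player_perfect_length_71_exists :
    ∃ tr : Trace 2 71, (tr.state (Fin.last 71)).s = 25 := by
  exact ⟨⟨fun t => longGameState t, fun t => longGameAction t, rfl, longGame_step⟩, rfl⟩
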